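/- arXiv:2005.12354 — 2 statements merged into one kernel-verified Lean document; each statement's English description precedes it below -/
import Mathlib

section
/- Let S ⊆ ℕ^d be a good semigroup, E ⊆ S a nonempty proper good ideal with conductor c_E, A = S \ E with levels A₁,…,A_N, and F ⊊ U ⊆ I with F nonempty. Let α(U) be a U-subspace of A_i, and let θ(U) ∈ Δ^S_G(α(U)) with (U \ F) ⊆ G ⊊ U and θ(U), α(U) consecutive among U-subspaces of S. If Δ^E_F(α(U)) ≠ ∅, then θ(U) is a U-subspace of A_i. -/
/-! Common definitions for good semigroups in `ℕ^d`. -/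

/-- A *good semigroup*: a submonoid of `ℕ^d` satisfying (G1), (G2), (G3). -/
def IsGoodSemigroup {d : ℕ} (S : Set (Fin d → ℕ)) : Prop :=
  (0 : Fin d → ℕ) ∈ S ∧
  (∀ α ∈ S, ∀ β ∈ S, α + β ∈ S) ∧
  (∀ α ∈ S, ∀ β ∈ S, α ⊓ β ∈ S) ∧
  (∀ α ∈ S, ∀ β ∈ S, α ≠ β → ∀ i : Fin d, α i = β i →
    ∃ ε ∈ S, α i < ε i ∧ ∀ j : Fin d, j ≠ i →
      min (α j) (β j) ≤ ε j ∧ (α j ≠ β j → ε j = min (α j) (β j))) ∧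
  (∃ c : Fin d → ℕ, ∀ x : Fin d → ℕ, c ≤ x → x ∈ S)

/-- A *good ideal* of `S`: a nonempty subset `E ⊆ S` with `E + S ⊆ E`
satisfying (G1) and (G2). -/
def IsGoodIdeal {d : ℕ} (S E : Set (Fin d → ℕ)) : Prop :=
  E ⊆ S ∧ E.Nonempty ∧
  (∀ α ∈ E, ∀ σ ∈ S, α + σ ∈ E) ∧
  (∀ α ∈ E, ∀ β ∈ E, α ⊓ β ∈ E) ∧
  (∀ α ∈ E, ∀ β ∈ E, α ≠ β → ∀ i : Fin d, α i = β i →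
    ∃ ε ∈ E, α i < ε i ∧ ∀ j : Fin d, j ≠ i →
      min (α j) (β j) ≤ ε j ∧ (α j ≠ β j → ε j = min (α j) (β j)))

/-- `Δ^E_F(α)`. -/
def DeltaSet {d : ℕ} (E : Set (Fin d → ℕ)) (F : Finset (Fin d)) (α : Fin d → ℕ) :
    Set (Fin d → ℕ) :=
  {β | β ∈ E ∧ (∀ i ∈ F, β i = α i) ∧ ∀ j ∉ F, α j < β j}

/-- `Δ̃^E_F(α)`. -/
def DeltaTilde {d : ℕ} (E : Set (Fin d → ℕ)) (F : Finset (Fin d)) (α : Fin d → ℕ) :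
    Set (Fin d → ℕ) :=
  {β | β ∈ E ∧ (∀ i ∈ F, β i = α i) ∧ ∀ j ∉ F, α j ≤ β j} \ {α}

/-- `c` is the conductor of `E`: the minimal element with `c + ℕ^d ⊆ E`. -/
def IsConductor {d : ℕ} (E : Set (Fin d → ℕ)) (c : Fin d → ℕ) : Prop :=
  (∀ x : Fin d → ℕ, c ≤ x → x ∈ E) ∧
  ∀ c' : Fin d → ℕ, (∀ x : Fin d → ℕ, c' ≤ x → x ∈ E) → c ≤ c'

/-- `α ≤ β` are consecutive in `A`. -/
def ConsecutiveIn {d : ℕ} (A : Set (Fin d → ℕ)) (α β : Fin d → ℕ) : Prop :=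
  α ∈ A ∧ β ∈ A ∧ α ≤ β ∧
  ∀ δ ∈ A, α ≤ δ → δ ≤ β → δ = α ∨ δ = β

/-- `α` is the complete infimum of the family `β` (with `Δ`-sets taken in `S`). -/
def IsCompleteInf {d : ℕ} (S : Set (Fin d → ℕ)) (α : Fin d → ℕ) {r : ℕ}
    (β : Fin r → Fin d → ℕ) : Prop :=
  2 ≤ r ∧ ∃ F : Fin r → Finset (Fin d),
    (∀ j, (F j).Nonempty ∧ F j ≠ Finset.univ) ∧
    (∀ j, β j ∈ DeltaSet S (F j) α) ∧
    (∀ j k, j ≠ k → α = β j ⊓ β k) ∧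
    (∀ x : Fin d, ∃ j, x ∉ F j)

/-- `α` is a complete infimum in `A` of the elements of the family `β`. -/
def IsCompleteInfIn {d : ℕ} (S A : Set (Fin d → ℕ)) (α : Fin d → ℕ) {r : ℕ}
    (β : Fin r → Fin d → ℕ) : Prop :=
  α ∈ A ∧ (∀ k, β k ∈ A) ∧ IsCompleteInf S α β

/-- The order `≤≤`: `α = β` or `α_j < β_j` for every `j`. -/
def DomLE {d : ℕ} (α β : Fin d → ℕ) : Prop := α = β ∨ ∀ j, α j < β j

/-- The set `B`: maximal elements of `(S \ E) \ prev` with respect to `≤≤`. -/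
def Bstep {d : ℕ} (S E prev : Set (Fin d → ℕ)) : Set (Fin d → ℕ) :=
  {α | α ∈ (S \ E) \ prev ∧ ∀ β ∈ (S \ E) \ prev, DomLE α β → β = α}

/-- The set `C`: elements of `B` that are complete infima in `S \ E` of
elements of `B` (with `1 < r ≤ d`). -/
def Cstep {d : ℕ} (S E prev : Set (Fin d → ℕ)) : Set (Fin d → ℕ) :=
  {α | α ∈ Bstep S E prev ∧ ∃ r : ℕ, 1 < r ∧ r ≤ d ∧
    ∃ β : Fin r → Fin d → ℕ, (∀ k, β k ∈ Bstep S E prev) ∧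
      IsCompleteInfIn S (S \ E) α β}

/-- `D = B \ C`. -/
def Dstep {d : ℕ} (S E prev : Set (Fin d → ℕ)) : Set (Fin d → ℕ) :=
  Bstep S E prev \ Cstep S E prev

/-- `Dacc S E i = D^(1) ∪ ⋯ ∪ D^(i)`. -/
def Dacc {d : ℕ} (S E : Set (Fin d → ℕ)) : ℕ → Set (Fin d → ℕ)
  | 0 => ∅
  | (i + 1) => Dacc S E i ∪ Dstep S E (Dacc S E i)

/-- `N` is the number of levels of `S \ E`: the least `N` with
`S \ E = D^(1) ∪ ⋯ ∪ D^(N)`. -/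
def IsLevelsNumber {d : ℕ} (S E : Set (Fin d → ℕ)) (N : ℕ) : Prop :=
  (S \ E) ⊆ Dacc S E N ∧ ∀ M : ℕ, (S \ E) ⊆ Dacc S E M → N ≤ M

/-- The level `A_i := D^(N+1-i)` for `1 ≤ i ≤ N` (and `∅` otherwise). -/
def Alevel {d : ℕ} (S E : Set (Fin d → ℕ)) (N i : ℕ) : Set (Fin d → ℕ) :=
  if 1 ≤ i ∧ i ≤ N then Dstep S E (Dacc S E (N - i)) else ∅

/-- `α` is (the representative of) a `U`-subspace of `E` (w.r.t. conductor `cE`):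
`α ∈ E` and `α_j = cE_j` for every `j ∉ U`. -/
def IsSubspaceRep {d : ℕ} (E : Set (Fin d → ℕ)) (cE : Fin d → ℕ)
    (U : Finset (Fin d)) (α : Fin d → ℕ) : Prop :=
  α ∈ E ∧ ∀ j ∉ U, α j = cE j

/-- `β(U) ∈ Δ^E_F(α(U))`, at the level of representatives. -/
def SubDelta {d : ℕ} (E : Set (Fin d → ℕ)) (cE : Fin d → ℕ)
    (U F : Finset (Fin d)) (α β : Fin d → ℕ) : Prop :=
  IsSubspaceRep E cE U β ∧ (∀ j ∈ F, β j = α j) ∧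
  ∀ j ∈ U, j ∉ F → α j < β j

/-- `β(U) ∈ Δ̃^E_F(α(U))`, at the level of representatives. -/
def SubDeltaT {d : ℕ} (E : Set (Fin d → ℕ)) (cE : Fin d → ℕ)
    (U F : Finset (Fin d)) (α β : Fin d → ℕ) : Prop :=
  IsSubspaceRep E cE U β ∧ (∀ j ∈ F, β j = α j) ∧
  (∀ j ∈ U, j ∉ F → α j ≤ β j) ∧ ¬(∀ j ∈ U, β j = α j)

/-- `α(U) ≤ θ(U)` are consecutive among the `U`-subspaces of `S`. -/
def SubConsecutive {d : ℕ} (S : Set (Fin d → ℕ)) (cE : Fin d → ℕ)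
    (U : Finset (Fin d)) (α β : Fin d → ℕ) : Prop :=
  IsSubspaceRep S cE U α ∧ IsSubspaceRep S cE U β ∧ (∀ i ∈ U, α i ≤ β i) ∧
  ∀ δ : Fin d → ℕ, IsSubspaceRep S cE U δ → (∀ i ∈ U, α i ≤ δ i) →
    (∀ i ∈ U, δ i ≤ β i) → (∀ i ∈ U, δ i = α i) ∨ (∀ i ∈ U, δ i = β i)

/-- `α(U)` is the complete infimum of the family of `U`-subspaces `β`. -/
def SubIsCompleteInf {d : ℕ} (S : Set (Fin d → ℕ)) (cE : Fin d → ℕ)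
    (U : Finset (Fin d)) (α : Fin d → ℕ) {r : ℕ}
    (β : Fin r → Fin d → ℕ) : Prop :=
  2 ≤ r ∧ ∃ F : Fin r → Finset (Fin d),
    (∀ j, (F j).Nonempty ∧ F j ⊂ U) ∧
    (∀ j, SubDelta S cE U (F j) α (β j)) ∧
    (∀ j k, j ≠ k → ∀ i ∈ U, α i = min (β j i) (β k i)) ∧
    (∀ x : Fin d, ∃ j, x ∉ F j)

theorem ple {d : ℕ} {a b : Fin d → ℕ} (h : a ≤ b) (x : Fin d) : a x ≤ b x := h x

theorem pinf_apply {d : ℕ} (a b : Fin d → ℕ) (x : Fin d) : (a ⊓ b) x = min (a x) (b x) := rfl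

/-- `R n = A \ (D^(1) ∪ ⋯ ∪ D^(n))`. -/
def Rl {d : ℕ} (S E : Set (Fin d → ℕ)) (n : ℕ) : Set (Fin d → ℕ) := (S \ E) \ Dacc S E n

/-- `m` is the least element of `S` above `θ` with strictly larger `i`-th coordinate. -/
def IsT {d : ℕ} (S : Set (Fin d → ℕ)) (θ : Fin d → ℕ) (i : Fin d) (m : Fin d → ℕ) : Prop :=
  m ∈ S ∧ θ ≤ m ∧ θ i < m i ∧ ∀ ξ ∈ S, θ ≤ ξ → θ i < ξ i → m ≤ ξ

theorem exists_T {d : ℕ} {S : Set (Fin d → ℕ)} (hS : IsGoodSemigroup S)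
    (θ : Fin d → ℕ) (i : Fin d) : ∃ m, IsT S θ i m := by
  obtain ⟨-, -, hinf, -, c, hc⟩ := hS
  let X : Set (Fin d → ℕ) := {ξ | ξ ∈ S ∧ θ ≤ ξ ∧ θ i < ξ i}
  have hX : X.Nonempty := by
    refine ⟨fun j => c j + θ j + 1, hc _ ?_, ?_, ?_⟩
    · intro j; simp only; omega
    · intro j; simp only; omega
    · simp only; omega
  obtain ⟨m, hm, hmin⟩ := WellFounded.has_min (wellFounded_lt (α := Fin d → ℕ)) X hX
  refine ⟨m, hm.1, hm.2.1, hm.2.2, fun ξ h1 h2 h3 => ?_⟩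
  have hmem : m ⊓ ξ ∈ X :=
    ⟨hinf _ hm.1 _ h1, le_inf hm.2.1 h2, by simp only [pinf_apply]; exact lt_min hm.2.2 h3⟩
  have := hmin _ hmem
  have h4 : m ⊓ ξ = m := by
    by_contra hne
    exact this (lt_of_le_of_ne inf_le_left hne)
  exact inf_eq_left.mp h4

theorem IsT.eq_of {d : ℕ} {S : Set (Fin d → ℕ)} (hS : IsGoodSemigroup S)
    {θ η m : Fin d → ℕ} {i x : Fin d} (hm : IsT S θ i m) (hθ : θ ∈ S) (hη : η ∈ S)
    (hle : θ ≤ η) (hi : η i = θ i) (hx : θ x < η x) : m x = θ x := by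
  obtain ⟨-, -, -, hG2, -⟩ := hS
  have hne : θ ≠ η := by rintro rfl; exact lt_irrefl _ hx
  obtain ⟨ε, hε, h1, h2⟩ := hG2 θ hθ η hη hne i hi.symm
  have hmε : m ≤ ε := by
    refine hm.2.2.2 ε hε ?_ h1
    intro j
    by_cases hj : j = i
    · subst hj; exact h1.le
    · have := (h2 j hj).1
      rwa [min_eq_left (hle j)] at this
  have hxi : x ≠ i := by rintro rfl; omega
  have h3 := (h2 x hxi).2 hx.ne
  rw [min_eq_left (hle x)] at h3
  have := ple hmε x
  have := ple hm.2.1 x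
  omega

theorem Dstep_sub {d : ℕ} {S E : Set (Fin d → ℕ)} {n : ℕ} {α : Fin d → ℕ} :
    α ∈ Dstep S E (Dacc S E n) ↔ α ∈ Rl S E n ∧ α ∉ Rl S E (n + 1) := by
  constructor
  · intro h
    refine ⟨h.1.1, fun h' => h'.2 ?_⟩
    exact Or.inr h
  · rintro ⟨h1, h2⟩
    by_contra h
    refine h2 ⟨h1.1, ?_⟩
    rintro (h3 | h3)
    · exact h1.2 h3
    · exact h h3

theorem Rl_succ {d : ℕ} {S E : Set (Fin d → ℕ)} {n : ℕ} : Rl S E (n + 1) ⊆ Rl S E n :=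
  fun _ h => ⟨h.1, fun h' => h.2 (Or.inl h')⟩

theorem Rl_anti {d : ℕ} {S E : Set (Fin d → ℕ)} {n m : ℕ} (h : n ≤ m) :
    Rl S E m ⊆ Rl S E n := by
  induction h with
  | refl => exact subset_rfl
  | step _ ih => exact Rl_succ.trans ih

theorem Rl_index {d : ℕ} {S E : Set (Fin d → ℕ)} {n : ℕ} {α : Fin d → ℕ}
    (hS : α ∈ S) (hE : α ∉ E) (h : α ∉ Rl S E n) :
    ∃ k < n, α ∈ Rl S E k ∧ α ∉ Rl S E (k + 1) := by
  induction n with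
  | zero => exact absurd ⟨⟨hS, hE⟩, fun h => h⟩ h
  | succ n ih =>
    by_cases h' : α ∈ Rl S E n
    · exact ⟨n, Nat.lt_succ_self n, h', h⟩
    · obtain ⟨k, hk, h2⟩ := ih h'
      exact ⟨k, by omega, h2⟩

/-- Necessary condition for being in the next remainder. -/
theorem Rl_cover {d : ℕ} {S E : Set (Fin d → ℕ)} {n : ℕ} {θ : Fin d → ℕ}
    (h : θ ∈ Rl S E (n + 1)) (x : Fin d) : ∃ ζ ∈ Rl S E n, θ ≤ ζ ∧ θ x < ζ x := by
  have h0 := Rl_succ h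
  have hD : θ ∉ Dstep S E (Dacc S E n) := fun h' => (Dstep_sub.mp h').2 h
  by_cases hB : θ ∈ Bstep S E (Dacc S E n)
  · have hC : θ ∈ Cstep S E (Dacc S E n) := by
      by_contra hC
      exact hD ⟨hB, hC⟩
    obtain ⟨-, r, -, -, β, hβ, -, -, -, F, -, hF, -, hcov⟩ := hC
    obtain ⟨j, hj⟩ := hcov x
    refine ⟨β j, (hβ j).1, ?_, (hF j).2.2 x hj⟩
    intro y
    by_cases hy : y ∈ F j
    · exact ((hF j).2.1 y hy).ge
    · exact ((hF j).2.2 y hy).le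
  · have : ∃ β ∈ Rl S E n, DomLE θ β ∧ β ≠ θ := by
      by_contra hcon
      push Not at hcon
      exact hB ⟨h0, hcon⟩
    obtain ⟨β, hβ, hdom, hne⟩ := this
    rcases hdom with hdom | hdom
    · exact absurd hdom.symm hne
    · exact ⟨β, hβ, fun j => (hdom j).le, hdom x⟩

/-- Sufficient condition, given monotonicity. -/
theorem Rl_of_cover {d : ℕ} (hd : 1 ≤ d) {S E : Set (Fin d → ℕ)}
    (hS : IsGoodSemigroup S) (hE : IsGoodIdeal S E) {n : ℕ}
    (hmono : ∀ α β : Fin d → ℕ, α ∈ S → α ∉ E → α ≤ β → β ∈ Rl S E n → α ∈ Rl S E n)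
    {θ : Fin d → ℕ} (h : θ ∈ Rl S E n)
    (hcov : ∀ x, ∃ ζ ∈ Rl S E n, θ ≤ ζ ∧ θ x < ζ x) : θ ∈ Rl S E (n + 1) := by
  classical
  by_contra hcon
  obtain ⟨hB, hC⟩ := Dstep_sub.mpr ⟨h, hcon⟩
  apply hC
  have hθS : θ ∈ S := h.1.1
  have hθE : θ ∉ E := h.1.2
  -- upward closure of `B`
  have hup : ∀ γ ∈ Rl S E n, θ ≤ γ → γ ∈ Bstep S E (Dacc S E n) := by
    intro γ hγ hle
    refine ⟨hγ, fun δ hδ hdom => ?_⟩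
    rcases hdom with hdom | hdom
    · exact hdom.symm
    · exfalso
      have h1 := hB.2 δ hδ (Or.inr fun j => lt_of_le_of_lt (hle j) (hdom j))
      have h2 := hdom ⟨0, hd⟩
      have h3 := ple hle ⟨0, hd⟩
      rw [h1] at h2
      omega
  choose t ht using fun x => exists_T hS θ x
  have hblock : ∀ x y, θ y < t x y → t y = t x := by
    intro x y hxy
    have h1 : t y ≤ t x := (ht y).2.2.2 _ (ht x).1 (ht x).2.1 hxy
    refine le_antisymm h1 ?_
    refine (ht x).2.2.2 _ (ht y).1 (ht y).2.1 ?_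
    by_contra hlt
    have h2 : t y x = θ x := le_antisymm (not_lt.mp hlt) ((ht y).2.1 x)
    have := (ht x).eq_of hS hθS (ht y).1 (ht y).2.1 h2 (ht y).2.2.1
    omega
  have hdisj : ∀ x y, t x ≠ t y → ∀ z, ¬ (θ z < t x z ∧ θ z < t y z) := by
    rintro x y hne z ⟨h1, h2⟩
    exact hne ((hblock x z h1).symm.trans (hblock y z h2))
  obtain ⟨ζ, hζR, hζle, ⟨x₁, hx₁⟩, hbad⟩ : ∃ ζ ∈ Rl S E n, θ ≤ ζ ∧ (∃ x, θ x < ζ x) ∧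
      ∀ y, ζ y = θ y → t y ∉ E := by
    by_cases hex : ∃ x, t x ∈ E
    · obtain ⟨x, hx⟩ := hex
      obtain ⟨ζ, h1, h2, h3⟩ := hcov x
      refine ⟨ζ, h1, h2, ⟨x, h3⟩, fun y hy hyE => ?_⟩
      have hle : t x ≤ ζ := (ht x).2.2.2 _ h1.1.1 h2 h3
      by_cases hne : t x = t y
      · have h4 := ple hle y
        rw [hne] at h4
        have := (ht y).2.2.1
        omega
      · apply hθE
        have : t x ⊓ t y = θ := by
          funext z
          have h4 := hdisj x y hne z
          have h5 := ple ((ht x).2.1) z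
          have h6 := ple ((ht y).2.1) z
          simp only [pinf_apply]
          omega
        rw [← this]
        exact hE.2.2.2.1 _ hx _ hyE
    · push Not at hex
      obtain ⟨ζ, h1, h2, h3⟩ := hcov ⟨0, hd⟩
      exact ⟨ζ, h1, h2, ⟨_, h3⟩, fun y _ => hex y⟩
  let Z : Finset (Fin d) := Finset.univ.filter fun y => ζ y = θ y
  have hZ : ∀ y, y ∈ Z ↔ ζ y = θ y := by intro y; simp [Z]
  have hζdisj : ∀ y, ζ y = θ y → ∀ z, ¬ (θ z < ζ z ∧ θ z < t y z) := by
    rintro y hy z ⟨h1, h2⟩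
    have h3 := hblock y z h2
    have h4 : t z ≤ ζ := (ht z).2.2.2 _ hζR.1.1 hζle h1
    rw [h3] at h4
    have := ple h4 y
    have := (ht y).2.2.1
    omega
  have hZne : Z.Nonempty := by
    by_contra hne
    rw [Finset.not_nonempty_iff_eq_empty] at hne
    have h1 : ∀ j, θ j < ζ j := by
      intro j
      have h2 : j ∉ Z := by simp [hne]
      rw [hZ] at h2
      exact lt_of_le_of_ne (hζle j) (Ne.symm h2)
    have h2 := hB.2 ζ hζR (Or.inr h1)
    rw [h2] at hx₁
    exact lt_irrefl _ hx₁
  have hZcard : Z.card < d := by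
    have : Z ⊂ Finset.univ := by
      rw [Finset.ssubset_univ_iff]
      intro hu
      have : x₁ ∈ Z := by rw [hu]; exact Finset.mem_univ _
      rw [hZ] at this
      omega
    simpa using Finset.card_lt_card this
  let W : Finset (Fin d → ℕ) := insert ζ (Z.image t)
  have hWmem : ∀ w, w ∈ W ↔ w = ζ ∨ ∃ y, ζ y = θ y ∧ t y = w := by
    intro w
    simp [W, hZ]
  have hζnot : ζ ∉ Z.image t := by
    intro hmem
    obtain ⟨y, hy, hyt⟩ := Finset.mem_image.mp hmem
    rw [hZ] at hy
    have := (ht y).2.2.1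
    rw [hyt] at this
    omega
  have hWcard : W.card = (Z.image t).card + 1 := Finset.card_insert_of_notMem hζnot
  have hr1 : 1 < W.card := by
    have : 0 < (Z.image t).card := (hZne.image t).card_pos
    omega
  have hr2 : W.card ≤ d := by
    have : (Z.image t).card ≤ Z.card := Finset.card_image_le
    omega
  have hWR : ∀ w ∈ W, w ∈ Rl S E n ∧ θ ≤ w := by
    intro w hw
    rcases (hWmem w).mp hw with rfl | ⟨y, hy, rfl⟩
    · exact ⟨hζR, hζle⟩
    · refine ⟨?_, (ht y).2.1⟩
      obtain ⟨ξ, h1, h2, h3⟩ := hcov y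
      exact hmono _ ξ (ht y).1 (hbad y hy) ((ht y).2.2.2 _ h1.1.1 h2 h3) h1
  have hWpair : ∀ w ∈ W, ∀ w' ∈ W, w ≠ w' → ∀ z, ¬ (θ z < w z ∧ θ z < w' z) := by
    intro w hw w' hw' hne z
    rcases (hWmem w).mp hw with rfl | ⟨y, hy, rfl⟩
    · rcases (hWmem w').mp hw' with rfl | ⟨y', hy', rfl⟩
      · exact absurd rfl hne
      · exact hζdisj y' hy' z
    · rcases (hWmem w').mp hw' with rfl | ⟨y', hy', rfl⟩
      · intro h; exact hζdisj y hy z h.symm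
      · exact hdisj y y' hne z
  let e := W.equivFin.symm
  refine ⟨hB, W.card, hr1, hr2, fun k => (e k : Fin d → ℕ), ?_, h.1, ?_, hr1,
    fun k => Finset.univ.filter fun x => (e k : Fin d → ℕ) x = θ x, ?_, ?_, ?_, ?_⟩
  · intro k
    obtain ⟨h1, h2⟩ := hWR _ (e k).2
    exact hup _ h1 h2
  · intro k
    exact (hWR _ (e k).2).1.1
  · intro k
    constructor
    · rcases (hWmem _).mp (e k).2 with h1 | ⟨y, hy, h1⟩
      · obtain ⟨y, hy⟩ := hZne
        refine ⟨y, ?_⟩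
        rw [hZ] at hy
        simp [h1, hy]
      · refine ⟨x₁, ?_⟩
        have h2 := hζdisj y hy x₁
        have h3 := ple ((ht y).2.1) x₁
        simp only [Finset.mem_filter, Finset.mem_univ, true_and]
        rw [← h1]
        omega
    · intro hu
      beta_reduce at hu
      rcases (hWmem _).mp (e k).2 with h1 | ⟨y, hy, h1⟩
      · have : x₁ ∈ (Finset.univ.filter fun x => (e k : Fin d → ℕ) x = θ x) := by
          rw [hu]; exact Finset.mem_univ _
        simp only [Finset.mem_filter, Finset.mem_univ, true_and] at this
        rw [h1] at this
        omega
      · have : y ∈ (Finset.univ.filter fun x => (e k : Fin d → ℕ) x = θ x) := by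
          rw [hu]; exact Finset.mem_univ _
        simp only [Finset.mem_filter, Finset.mem_univ, true_and] at this
        rw [← h1] at this
        have := (ht y).2.2.1
        omega
  · intro k
    obtain ⟨h1, h2⟩ := hWR _ (e k).2
    refine ⟨h1.1.1, ?_, ?_⟩
    · intro x hx
      simpa using hx
    · intro x hx
      have hx' : ¬ (e k : Fin d → ℕ) x = θ x := by simpa using hx
      exact lt_of_le_of_ne (h2 x) (Ne.symm hx')
  · intro j k hjk
    have hne : (e j : Fin d → ℕ) ≠ (e k : Fin d → ℕ) := by
      intro heq
      exact hjk (e.injective (Subtype.ext heq))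
    funext z
    have h1 := hWpair _ (e j).2 _ (e k).2 hne z
    have h2 := ple ((hWR _ (e j).2).2) z
    have h3 := ple ((hWR _ (e k).2).2) z
    simp only [pinf_apply]
    omega
  · intro x
    by_cases hx : ζ x = θ x
    · have hm : t x ∈ W := (hWmem _).mpr (Or.inr ⟨x, hx, rfl⟩)
      refine ⟨e.symm ⟨t x, hm⟩, ?_⟩
      have := (ht x).2.2.1
      simp only [Finset.mem_filter, Finset.mem_univ, true_and, Equiv.apply_symm_apply]
      omega
    · have hm : ζ ∈ W := (hWmem _).mpr (Or.inl rfl)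
      refine ⟨e.symm ⟨ζ, hm⟩, ?_⟩
      simp only [Finset.mem_filter, Finset.mem_univ, true_and, Equiv.apply_symm_apply]
      exact hx

theorem Rl_mono {d : ℕ} (hd : 1 ≤ d) {S E : Set (Fin d → ℕ)}
    (hS : IsGoodSemigroup S) (hE : IsGoodIdeal S E) (n : ℕ) :
    ∀ α β : Fin d → ℕ, α ∈ S → α ∉ E → α ≤ β → β ∈ Rl S E n → α ∈ Rl S E n := by
  induction n with
  | zero => intro α β h1 h2 _ _; exact ⟨⟨h1, h2⟩, fun h => h⟩
  | succ n ih =>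
    intro α β h1 h2 hle hβ
    refine Rl_of_cover hd hS hE ih (ih α β h1 h2 hle (Rl_succ hβ)) fun x => ?_
    obtain ⟨ζ, h3, h4, h5⟩ := Rl_cover hβ x
    exact ⟨ζ, h3, hle.trans h4, lt_of_le_of_lt (hle x) h5⟩

theorem lemmaP {d : ℕ} (hd : 1 ≤ d) {S E : Set (Fin d → ℕ)}
    (hS : IsGoodSemigroup S) (hE : IsGoodIdeal S E) (F : Set (Fin d)) (n : ℕ) :
    ∀ θ : Fin d → ℕ, θ ∈ Rl S E n → θ ∉ Rl S E (n + 1) →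
      (∀ ξ ∈ S, θ ≤ ξ → (∀ x, x ∉ F → ξ x = θ x) → ξ ∉ E) →
      (∀ x, x ∉ F → ∃ η ∈ Rl S E n, θ ≤ η ∧ θ x < η x) → False := by
  induction n using Nat.strong_induction_on with
  | _ n ih =>
  intro θ hθ hθ' hF hη
  have : ∃ i, ∀ ζ ∈ Rl S E n, θ ≤ ζ → ζ i = θ i := by
    by_contra hcon
    push Not at hcon
    refine hθ' (Rl_of_cover hd hS hE (Rl_mono hd hS hE n) hθ fun x => ?_)
    obtain ⟨ζ, h1, h2, h3⟩ := hcon x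
    exact ⟨ζ, h1, h2, lt_of_le_of_ne (h2 x) (Ne.symm h3)⟩
  obtain ⟨i, hi⟩ := this
  obtain ⟨ε, hε⟩ := exists_T hS θ i
  have hεeq : ∀ x, x ∉ F → ε x = θ x := by
    intro x hx
    obtain ⟨η, h1, h2, h3⟩ := hη x hx
    exact hε.eq_of hS hθ.1.1 h1.1.1 h2 (hi η h1 h2) h3
  have hεE : ε ∉ E := hF ε hε.1 hε.2.1 hεeq
  have hεn : ε ∉ Rl S E n := by
    intro h
    have := hi ε h hε.2.1
    have := hε.2.2.1
    omega
  obtain ⟨k, hk, h1, h2⟩ := Rl_index hε.1 hεE hεn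
  refine ih k hk ε h1 h2 ?_ ?_
  · intro ξ h3 h4 h5
    exact hF ξ h3 (hε.2.1.trans h4) fun x hx => (h5 x hx).trans (hεeq x hx)
  · intro x hx
    obtain ⟨η, h3, h4, h5⟩ := hη x hx
    have hηi := hi η h3 h4
    obtain ⟨τ, h6, h7, h8⟩ := Rl_cover (Rl_anti (show k + 1 ≤ n by omega) h3) i
    refine ⟨τ, h6, hε.2.2.2 τ h6.1.1 (h4.trans h7) (by omega), ?_⟩
    have := ple h7 x
    have := hεeq x hx
    omega

theorem T_not_mem {d : ℕ} {S E : Set (Fin d → ℕ)}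
    (hS : IsGoodSemigroup S) (hE : IsGoodIdeal S E) {α β ω ξ : Fin d → ℕ} {i : Fin d}
    (hα : α ∈ S) (hαE : α ∉ E) (hβ : β ∈ E) (hle : α ≤ β) (hi : β i = α i) (hω : IsT S α i ω)
    (h1 : ω ≤ ξ) (h2 : ∀ x, α x < β x → ξ x = ω x) : ξ ∉ E := by
  intro hξ
  apply hαE
  have : ξ ⊓ β = α := by
    funext x
    have h3 := ple hω.2.1 x
    have h4 := ple h1 x
    have h5 := ple hle x
    simp only [pinf_apply]
    by_cases hx : α x < β x
    · have h6 := h2 x hx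
      have h7 := hω.eq_of hS hα (hE.1 hβ) hle hi hx
      omega
    · omega
  rw [← this]
  exact hE.2.2.2.1 _ hξ _ hβ

theorem lemmaT {d : ℕ} (hd : 1 ≤ d) {S E : Set (Fin d → ℕ)}
    (hS : IsGoodSemigroup S) (hE : IsGoodIdeal S E) (i : Fin d) (m : ℕ) :
    ∀ α β ω : Fin d → ℕ, α ∈ Rl S E (m + 1) → β ∈ E → α ≤ β → β i = α i → IsT S α i ω →
      ω ∈ Rl S E m → ω ∉ Rl S E (m + 1) → False := by
  induction m using Nat.strong_induction_on with
  | _ m ih =>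
  intro α β ω hα hβ hle hi hω hωm hωm'
  have hωeq : ∀ x, α x < β x → ω x = α x := fun x hx =>
    hω.eq_of hS hα.1.1 (hE.1 hβ) hle hi hx
  refine lemmaP hd hS hE {x | ¬ α x < β x} m ω hωm hωm' ?_ ?_
  · intro ξ hξ h1 h2
    exact T_not_mem hS hE hα.1.1 hα.1.2 hβ hle hi hω h1 fun x hx => h2 x (by simpa using hx)
  · intro x hx
    have hx : α x < β x := by simpa using hx
    suffices hsuff : ∃ ω' ∈ Rl S E m, α ≤ ω' ∧ α i < ω' i ∧ α x < ω' x by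
      obtain ⟨ω', h1, h2, h3, h4⟩ := hsuff
      refine ⟨ω', h1, hω.2.2.2 _ h1.1.1 h2 h3, ?_⟩
      rw [hωeq x hx]
      exact h4
    obtain ⟨ζ, hζ, hζle, hζx⟩ := Rl_cover hα x
    by_cases hζi : α i < ζ i
    · exact ⟨ζ, hζ, hζle, hζi, hζx⟩
    have hζi : ζ i = α i := le_antisymm (not_lt.mp hζi) (hζle i)
    by_cases hcase : ∃ b ∈ E, α ≤ b ∧ b i = α i ∧ α x < b x ∧ b ⊓ ζ ∉ E
    · obtain ⟨b, hb, hb1, hb2, hb3, hb4⟩ := hcase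
      have hS' : b ⊓ ζ ∈ S := hS.2.2.1 _ (hE.1 hb) _ hζ.1.1
      have hR' : b ⊓ ζ ∈ Rl S E m := Rl_mono hd hS hE m _ ζ hS' hb4 inf_le_right hζ
      obtain ⟨ω', hω'⟩ := exists_T hS (b ⊓ ζ) i
      have hbi : b i = (b ⊓ ζ) i := by simp only [pinf_apply]; omega
      have hω'E : ω' ∉ E :=
        T_not_mem hS hE hS' hb4 hb inf_le_left hbi hω' le_rfl fun _ _ => rfl
      have h1 := hω'.2.2.1
      have h2 := ple hω'.2.1 x
      have h3 : α x < (b ⊓ ζ) x := by simp only [pinf_apply]; omega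
      refine ⟨ω', ?_, (le_inf hb1 hζle).trans hω'.2.1, by omega, by omega⟩
      by_contra hcon
      obtain ⟨k, hk, h4, h5⟩ := Rl_index hω'.1 hω'E hcon
      exact ih k hk _ b ω' (Rl_anti (show k + 1 ≤ m by omega) hR') hb inf_le_left hbi hω' h4 h5
    · push Not at hcase
      let Y : Set (Fin d → ℕ) := {e | e ∈ E ∧ α ≤ e ∧ e ≤ ζ ∧ α x < e x}
      have hYfin : Y.Finite := (Set.finite_Iic ζ).subset fun e he => he.2.2.1
      have hYne : Y.Nonempty := by
        refine ⟨β ⊓ ζ, hcase β hβ hle hi hx, le_inf hle hζle, inf_le_right, ?_⟩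
        simp only [pinf_apply]; omega
      obtain ⟨e, ⟨heE, hαe, heζ, hex⟩, hmax⟩ := hYfin.exists_maximal hYne
      have hei : e i = α i := by
        have := ple hαe i
        have := ple heζ i
        omega
      obtain ⟨ω', hω'⟩ := exists_T hS e i
      have hω'eq : ∀ y, e y < ζ y → ω' y = e y := fun y hy =>
        hω'.eq_of hS (hE.1 heE) hζ.1.1 heζ (by omega) hy
      obtain ⟨y, hy⟩ : ∃ y, e y < ζ y := by
        by_contra hcon
        push Not at hcon
        have : e = ζ := le_antisymm heζ hcon
        exact hζ.1.2 (this ▸ heE)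
      have hrow : ∀ ξ ∈ S, ω' ≤ ξ → (∀ z, z ∉ {z | ¬ e z < ζ z} → ξ z = ω' z) → ξ ∉ E := by
        intro ξ _ h1 h2 hξE
        have h3 : ξ y = e y := (h2 y (by simpa using hy)).trans (hω'eq y hy)
        have h4 : e i < ξ i := lt_of_lt_of_le hω'.2.2.1 (h1 i)
        have heξ : e ≤ ξ := hω'.2.1.trans h1
        have hne : e ≠ ξ := by rintro rfl; exact lt_irrefl _ h4
        obtain ⟨e', he', h5, h6⟩ := hE.2.2.2.2 e heE ξ hξE hne y h3.symm
        have hee' : e ≤ e' := by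
          intro j
          by_cases hj : j = y
          · subst hj; exact h5.le
          · have := (h6 j hj).1
            rwa [min_eq_left (heξ j)] at this
        have hiy : i ≠ y := by rintro rfl; omega
        have h7 : e' i = e i := by
          have := (h6 i hiy).2 h4.ne
          rwa [min_eq_left (heξ i)] at this
        have h8 : α x < e' x := lt_of_lt_of_le hex (hee' x)
        have h9 := hcase e' he' (hαe.trans hee') (h7.trans hei) h8
        have h10 : e' ⊓ ζ ∈ Y := by
          refine ⟨h9, le_inf (hαe.trans hee') hζle, inf_le_right, ?_⟩
          simp only [pinf_apply]; omega
        have h11 := ple (hmax h10 (le_inf hee' heζ)) y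
        simp only [pinf_apply] at h11
        omega
      have hω'E : ω' ∉ E := hrow ω' hω'.1 le_rfl fun _ _ => rfl
      have h1 := hω'.2.2.1
      have h2 := ple hω'.2.1 x
      refine ⟨ω', ?_, hαe.trans hω'.2.1, by omega, by omega⟩
      by_contra hcon
      obtain ⟨k, hk, h4, h5⟩ := Rl_index hω'.1 hω'E hcon
      obtain ⟨τ, h6, h7, h8⟩ := Rl_cover (Rl_anti (show k + 1 ≤ m by omega) hζ) i
      refine lemmaP hd hS hE {z | ¬ e z < ζ z} k ω' h4 h5 hrow ?_
      intro z hz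
      have hz : e z < ζ z := by simpa using hz
      refine ⟨τ, h6, hω'.2.2.2 τ h6.1.1 (heζ.trans h7) (by omega), ?_⟩
      have := hω'eq z hz
      have := ple h7 z
      omega

theorem stmt_17 {d : ℕ} (hd : 1 ≤ d) (S E : Set (Fin d → ℕ))
    (hS : IsGoodSemigroup S) (hE : IsGoodIdeal S E) (hprop : E ≠ S)
    (cE : Fin d → ℕ) (hcE : IsConductor E cE)
    (N : ℕ) (hN : IsLevelsNumber S E N)
    (U F G : Finset (Fin d)) (hU : U.Nonempty) (hFne : F.Nonempty) (hF : F ⊂ U)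
    (hGF : U \ F ⊆ G) (hG : G ⊂ U)
    (i : ℕ) (α θ : Fin d → ℕ)
    (hαrep : ∀ j ∉ U, α j = cE j) (hαi : α ∈ Alevel S E N i)
    (hθ : SubDelta S cE U G α θ)
    (hcons : SubConsecutive S cE U α θ)
    (hEF : ∃ β : Fin d → ℕ, SubDelta E cE U F α β) :
    θ ∈ Alevel S E N i := by
  unfold Alevel at hαi ⊢
  split_ifs at hαi ⊢ with hi
  swap
  · exact hαi
  rw [Dstep_sub] at hαi ⊢
  obtain ⟨hα, hα'⟩ := hαi
  obtain ⟨β, ⟨hβE, hβU⟩, hβF, hβgt⟩ := hEF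
  obtain ⟨⟨hθS, hθU⟩, hθG, hθgt⟩ := hθ
  obtain ⟨-, -, -, hbet⟩ := hcons
  have hαβ : α ≤ β := by
    intro j
    by_cases hjU : j ∈ U
    · by_cases hjF : j ∈ F
      · exact (hβF j hjF).ge
      · exact (hβgt j hjU hjF).le
    · rw [hβU j hjU, hαrep j hjU]
  have hαθ : α ≤ θ := by
    intro j
    by_cases hjU : j ∈ U
    · by_cases hjG : j ∈ G
      · exact (hθG j hjG).ge
      · exact (hθgt j hjU hjG).le
    · rw [hθU j hjU, hαrep j hjU]
  obtain ⟨i₀, hi₀U, hi₀G⟩ := Finset.exists_of_ssubset hG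
  have hi₀F : i₀ ∈ F := by
    by_contra hcon
    exact hi₀G (hGF (Finset.mem_sdiff.mpr ⟨hi₀U, hcon⟩))
  have hT : IsT S α i₀ θ := by
    refine ⟨hθS, hαθ, hθgt i₀ hi₀U hi₀G, ?_⟩
    intro ξ hξ h1 h2 j
    change θ j ≤ ξ j
    have h3 : IsSubspaceRep S cE U (ξ ⊓ θ) := by
      refine ⟨hS.2.2.1 _ hξ _ hθS, fun j hj => ?_⟩
      have h4 := ple h1 j
      have h5 := hθU j hj
      have h6 := hαrep j hj
      simp only [pinf_apply]
      omega
    by_cases hj : j ∈ U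
    · rcases hbet _ h3 (fun k _ => le_inf h1 hαθ k) (fun k _ => inf_le_right (a := ξ) k)
        with h4 | h4
      · have h5 := h4 i₀ hi₀U
        have h6 := hθgt i₀ hi₀U hi₀G
        simp only [pinf_apply] at h5
        omega
      · have h5 := h4 j hj
        simp only [pinf_apply] at h5
        omega
    · have h4 := ple h1 j
      have h5 := hθU j hj
      have h6 := hαrep j hj
      omega
  have hβi : β i₀ = α i₀ := hβF i₀ hi₀F
  have hθE : θ ∉ E :=
    T_not_mem hS hE hα.1.1 hα.1.2 hβE hαβ hβi hT le_rfl fun _ _ => rfl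
  constructor
  · by_contra hcon
    obtain ⟨k, hk, h1, h2⟩ := Rl_index hθS hθE hcon
    exact lemmaT hd hS hE i₀ k α β θ (Rl_anti (show k + 1 ≤ N - i by omega) hα)
      hβE hαβ hβi hT h1 h2
  · intro h
    exact hα' (Rl_mono hd hS hE _ α θ hα.1.1 hα.1.2 hαθ h)
end

section
/- Let S ⊆ ℕ^d be a good semigroup, E ⊆ S a nonempty proper good ideal with conductor c_E, A = S \ E with levels A₁,…,A_N, and U ⊆ I nonempty. Suppose α(U) is a U-subspace of the level A_i and that A_i contains no subspace of dimension d − |U| + 1 or larger (so α(U) has maximal dimension among subspaces contained in A_i). Then for every k ∈ U there exists a U-subspace β(U) of A_i with β_k ≥ α_k such that every U-subspace in H_k(β(U)) is a U-subspace of A. -/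
theorem lej {d : ℕ} {α β : Fin d → ℕ} (h : α ≤ β) (j : Fin d) : α j ≤ β j := h j

theorem infa {d : ℕ} (α β : Fin d → ℕ) (j : Fin d) : (α ⊓ β) j = min (α j) (β j) := rfl

/-- Property (G1). -/
def PropG1 {d : ℕ} (X : Set (Fin d → ℕ)) : Prop := ∀ α ∈ X, ∀ β ∈ X, α ⊓ β ∈ X

/-- Property (G2). -/
def PropG2 {d : ℕ} (X : Set (Fin d → ℕ)) : Prop :=
  ∀ α ∈ X, ∀ β ∈ X, α ≠ β → ∀ i : Fin d, α i = β i →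
    ∃ ε ∈ X, α i < ε i ∧ ∀ j : Fin d, j ≠ i →
      min (α j) (β j) ≤ ε j ∧ (α j ≠ β j → ε j = min (α j) (β j))

/-- A combinatorial description of the set of elements surviving `n` removal steps. -/
def Qs {d : ℕ} (A : Set (Fin d → ℕ)) : ℕ → Set (Fin d → ℕ)
  | 0 => A
  | (n + 1) => {α | α ∈ A ∧ ∀ i, ∃ δ ∈ Qs A n, α ≤ δ ∧ α i < δ i}

theorem Qs_sub {d : ℕ} {A : Set (Fin d → ℕ)} {n : ℕ} {α : Fin d → ℕ} (h : α ∈ Qs A n) :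
    α ∈ A := by
  cases n with
  | zero => exact h
  | succ n => exact h.1

theorem Qs_down {d : ℕ} {A : Set (Fin d → ℕ)} {n : ℕ} {α β : Fin d → ℕ} (h : β ∈ Qs A n)
    (hα : α ∈ A) (hle : α ≤ β) : α ∈ Qs A n := by
  cases n with
  | zero => exact hα
  | succ n =>
    refine ⟨hα, fun i => ?_⟩
    obtain ⟨δ, hδ, h1, h2⟩ := h.2 i
    exact ⟨δ, hδ, hle.trans h1, lt_of_le_of_lt (hle i) h2⟩

theorem Qs_anti {d : ℕ} {A : Set (Fin d → ℕ)} {n : ℕ} : ∀ {α : Fin d → ℕ},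
    α ∈ Qs A (n + 1) → α ∈ Qs A n := by
  induction n with
  | zero => intro α h; exact h.1
  | succ n ih =>
    intro α h
    refine ⟨h.1, fun i => ?_⟩
    obtain ⟨δ, hδ, h1, h2⟩ := h.2 i
    exact ⟨δ, ih hδ, h1, h2⟩

theorem exists_min_of {X : Type*} (p : X → Prop) (f : X → ℕ) (h : ∃ x, p x) :
    ∃ x, p x ∧ ∀ y, p y → f x ≤ f y := by
  obtain ⟨x, hx⟩ := h
  have := WellFounded.has_min (measure f).wf {x | p x} ⟨x, hx⟩
  obtain ⟨m, hm, hmin⟩ := this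
  exact ⟨m, hm, fun y hy => not_lt.1 (hmin y hy)⟩

theorem exists_max_of {X : Type*} (p : X → Prop) (f : X → ℕ) (b : ℕ)
    (hb : ∀ x, p x → f x ≤ b) (h : ∃ x, p x) :
    ∃ x, p x ∧ ∀ y, p y → f y ≤ f x := by
  obtain ⟨m, hm, h2⟩ := exists_min_of p (fun x => b - f x) h
  refine ⟨m, hm, fun y hy => ?_⟩
  have := h2 y hy
  have := hb y hy
  have := hb m hm
  omega

theorem minel {d : ℕ} {S : Set (Fin d → ℕ)} (h1 : PropG1 S) (α : Fin d → ℕ) (i : Fin d)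
    (hne : ∃ y ∈ S, α ≤ y ∧ α i < y i) :
    ∃ x ∈ S, α ≤ x ∧ α i < x i ∧ ∀ z ∈ S, α ≤ z → α i < z i → x ≤ z := by
  obtain ⟨x, ⟨hx, hx1, hx2⟩, hmin⟩ :=
    exists_min_of (fun y => y ∈ S ∧ α ≤ y ∧ α i < y i) (fun y => ∑ j, y j) hne
  refine ⟨x, hx, hx1, hx2, fun z hz hz1 hz2 => ?_⟩
  have h := hmin (x ⊓ z) ⟨h1 x hx z hz, le_inf hx1 hz1, lt_min hx2 hz2⟩
  intro j
  by_contra hj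
  change ¬ (x j ≤ z j) at hj
  have : ∑ j, (x ⊓ z) j < ∑ j, x j :=
    Finset.sum_lt_sum (fun l _ => min_le_left _ _)
      ⟨j, Finset.mem_univ _, by simp only [infa]; omega⟩
  omega

/-- Singleton shields. -/
theorem star {d : ℕ} {S A : Set (Fin d → ℕ)} (hAS : A ⊆ S) (h1 : PropG1 S) (h2 : PropG2 S)
    (n : ℕ) : ∀ β ∈ S, ∀ i : Fin d, (∀ z ∈ S, β ≤ z → z i = β i → z ∈ A) →
      ∀ q ∈ Qs A n, β ≤ q → β i < q i → ∀ k, ∃ δ ∈ Qs A n, β ≤ δ ∧ β k < δ k := by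
  induction n with
  | zero =>
    intro β hβ i hsh q hq hle hlt k
    by_cases hk : β k < q k
    · exact ⟨q, hq, hle, hk⟩
    have hk' : β k = q k := le_antisymm (hle k) (not_lt.1 hk)
    obtain ⟨ε, hε, e1, e2⟩ := h2 β hβ q (hAS (Qs_sub hq)) (by rintro rfl; omega) k hk'
    have hβε : β ≤ ε := by
      intro j
      change β j ≤ ε j
      by_cases hj : j = k
      · subst hj; exact e1.le
      · have := (e2 j hj).1
        have := lej (hle) j
        omega
    have hik : i ≠ k := by rintro rfl; omega
    have hεi : ε i = β i := by
      have := (e2 i hik).2 (by omega)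
      omega
    exact ⟨ε, hsh ε hε hβε hεi, hβε, e1⟩
  | succ n ih =>
    intro β hβ i hsh q hq hle hlt k
    by_cases hk : β k < q k
    · exact ⟨q, hq, hle, hk⟩
    have hk' : β k = q k := le_antisymm (hle k) (not_lt.1 hk)
    obtain ⟨ε, hε, e1, e2⟩ := h2 β hβ q (hAS (Qs_sub hq)) (by rintro rfl; omega) k hk'
    have hβε : β ≤ ε := by
      intro j
      change β j ≤ ε j
      by_cases hj : j = k
      · subst hj; exact e1.le
      · have := (e2 j hj).1
        have := lej (hle) j
        omega
    have hik : i ≠ k := by rintro rfl; omega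
    have hεi : ε i = β i := by
      have := (e2 i hik).2 (by omega)
      omega
    obtain ⟨x, hx, hβx, hxk, hxm⟩ := minel h1 β k ⟨ε, hε, hβε, e1⟩
    have hxi : x i = β i := by
      have := lej (hxm ε hε hβε e1) i
      have := lej (hβx) i
      omega
    refine ⟨x, ⟨hsh x hx hβx hxi, fun j => ?_⟩, hβx, hxk⟩
    obtain ⟨σ, hσ, s1, s2⟩ := hq.2 k
    have hxσ : x ≤ σ := hxm σ (hAS (Qs_sub hσ)) (hle.trans s1) (by omega)
    refine ih x hx i ?_ σ hσ hxσ ?_ j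
    · intro z hz hxz hzi
      exact hsh z hz (hβx.trans hxz) (by omega)
    · have := lej (s1) i
      omega

theorem claim {d : ℕ} {S E : Set (Fin d → ℕ)} (hES : E ⊆ S) (h1 : PropG1 S) (h2 : PropG2 S)
    (e1 : PropG1 E) (e2 : PropG2 E) (n : ℕ) : ∀ ρ ∈ Qs (S \ E) n, ∀ γ ∈ E, ∀ k, ρ k = γ k →
      ∃ δ ∈ Qs (S \ E) n, ρ ⊓ γ ≤ δ ∧ ρ k < δ k := by
  have hAS : S \ E ⊆ S := fun x hx => hx.1
  induction n with
  | zero =>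
    intro ρ hρ γ₀ hγ₀ k hk₀
    obtain ⟨γ, ⟨hγ, hk, hγl⟩, hmax⟩ := exists_max_of
      (fun γ => γ ∈ E ∧ ρ k = γ k ∧ ρ ⊓ γ₀ ≤ γ) (fun γ => ∑ j, min (ρ j) (γ j)) (∑ j, ρ j)
      (fun γ _ => Finset.sum_le_sum fun j _ => min_le_left _ _) ⟨γ₀, hγ₀, hk₀, inf_le_right⟩
    have hρA : ρ ∈ S \ E := Qs_sub hρ
    obtain ⟨x, hx, hxk, hx2⟩ := h2 ρ hρA.1 γ (hES hγ) (by rintro rfl; exact hρA.2 hγ) k hk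
    have hle : ρ ⊓ γ ≤ x := by
      intro j
      by_cases hj : j = k
      · subst hj; exact (min_le_left _ _).trans hxk.le
      · exact (hx2 j hj).1
    refine ⟨x, ⟨hx, fun hxE => ?_⟩, (le_inf inf_le_left hγl).trans hle, hxk⟩
    by_cases hc : ρ ≤ γ
    · apply hρA.2
      have : ρ = x ⊓ γ := by
        funext j
        simp only [infa]
        have a := lej (hc) j
        by_cases hj : j = k
        · subst hj; omega
        · have := (hx2 j hj).1
          have b := (hx2 j hj).2
          by_cases h : ρ j = γ j
          · omega
          · have := b h; omega
      rw [this]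
      exact e1 x hxE γ hγ
    · obtain ⟨i, hi⟩ : ∃ i, ¬ ρ i ≤ γ i := by
        by_contra hh; push Not at hh; exact hc hh
      have hik : i ≠ k := by rintro rfl; omega
      have hxi : x i = γ i := by
        have := (hx2 i hik).2 (by omega)
        omega
      obtain ⟨η, hη, hηi, hη2⟩ := e2 γ hγ x hxE (by rintro rfl; omega) i hxi.symm
      have hηk : η k = γ k := by
        have := (hη2 k hik.symm).2 (by omega)
        omega
      have hle2 : ρ ⊓ γ ≤ η := by
        intro j
        have hl := lej (hle) j
        simp only [infa] at hl ⊢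
        by_cases hj : j = i
        · subst hj; omega
        · have := (hη2 j hj).1
          omega
      have := hmax η ⟨hη, by omega, (le_inf inf_le_left hγl).trans hle2⟩
      have hlt : ∑ j, min (ρ j) (γ j) < ∑ j, min (ρ j) (η j) := by
        refine Finset.sum_lt_sum (fun l _ => ?_) ⟨i, Finset.mem_univ _, by omega⟩
        have := lej (hle2) l
        simp only [infa] at this
        omega
      omega
  | succ n ih =>
    intro ρ hρ γ₀ hγ₀ k hk₀
    have hρA : ρ ∈ S \ E := Qs_sub hρ
    obtain ⟨γ, ⟨hγ, hk, hγl⟩, hmax⟩ := exists_max_of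
      (fun γ => γ ∈ E ∧ ρ k = γ k ∧ ρ ⊓ γ₀ ≤ γ) (fun γ => ∑ j, min (ρ j) (γ j)) (∑ j, ρ j)
      (fun γ _ => Finset.sum_le_sum fun j _ => min_le_left _ _) ⟨γ₀, hγ₀, hk₀, inf_le_right⟩
    by_cases hc : ρ ≤ γ
    · -- comparable case: pass to an element of `E` of minimal support
      clear hmax
      obtain ⟨γ', ⟨hγ', hk', hργ'⟩, hmin⟩ := exists_min_of
        (fun γ' => γ' ∈ E ∧ ρ k = γ' k ∧ ρ ≤ γ')
        (fun γ' => (Finset.univ.filter fun j => ρ j < γ' j).card) ⟨γ, hγ, hk, hc⟩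
      have hne : ρ ≠ γ' := by rintro rfl; exact hρA.2 hγ'
      obtain ⟨i, hi⟩ : ∃ i, ρ i < γ' i := by
        by_contra hh; push Not at hh; exact hne (le_antisymm hργ' hh)
      have hshield : ∀ z ∈ S, ρ ≤ z → z i = ρ i → z ∈ S \ E := by
        intro z hz hρz hzi
        refine ⟨hz, fun hzE => ?_⟩
        have := hmin (z ⊓ γ') ⟨e1 z hzE γ' hγ', by
          have := lej (hρz) k
          simp only [infa]; omega, le_inf hρz hργ'⟩
        have hlt : (Finset.univ.filter fun j => ρ j < (z ⊓ γ') j).card <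
            (Finset.univ.filter fun j => ρ j < γ' j).card := by
          apply Finset.card_lt_card
          rw [Finset.ssubset_iff_of_subset]
          · refine ⟨i, by simp [hi], by simp [hzi]⟩
          · intro j
            simp only [Finset.mem_filter, Finset.mem_univ, true_and, infa]
            omega
        omega
      obtain ⟨ε, hε, hεk, hε2⟩ := h2 ρ hρA.1 γ' (hES hγ') hne k hk'
      have hρε : ρ ≤ ε := by
        intro j
        change ρ j ≤ ε j
        by_cases hj : j = k
        · subst hj; exact hεk.le
        · have := (hε2 j hj).1
          have := lej (hργ') j
          omega
      have hik : i ≠ k := by rintro rfl; omega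
      have hεi : ε i = ρ i := by
        have := (hε2 i hik).2 (by omega)
        omega
      obtain ⟨x, hx, hρx, hxk, hxm⟩ := minel h1 ρ k ⟨ε, hε, hρε, hεk⟩
      have hxi : x i = ρ i := by
        have := lej (hxm ε hε hρε hεk) i
        have := lej (hρx) i
        omega
      refine ⟨x, ⟨hshield x hx hρx hxi, fun j => ?_⟩, inf_le_left.trans hρx, hxk⟩
      obtain ⟨q, hq, hxq, hqi⟩ : ∃ q ∈ Qs (S \ E) n, x ≤ q ∧ x i < q i := by
        obtain ⟨σ, hσ, s1, s2⟩ := hρ.2 i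
        by_cases hσk : ρ k < σ k
        · exact ⟨σ, hσ, hxm σ (Qs_sub hσ).1 s1 hσk, by omega⟩
        · have hs := lej (s1) k
          obtain ⟨δ, hδ, d1, d2⟩ := ih σ hσ γ' hγ' k (by omega)
          refine ⟨δ, hδ, hxm δ (Qs_sub hδ).1 ((le_inf s1 hργ').trans d1) (by omega), ?_⟩
          have := lej (d1) i
          simp only [infa] at this
          omega
      exact star hAS h1 h2 n x hx i
        (fun z hz hxz hzi => hshield z hz (hρx.trans hxz) (by omega)) q hq hxq hqi j
    · obtain ⟨i, hi⟩ : ∃ i, ¬ ρ i ≤ γ i := by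
        by_contra hh; push Not at hh; exact hc hh
      have hik : i ≠ k := by rintro rfl; omega
      obtain ⟨ε, hε, hεk, hε2⟩ :=
        h2 ρ hρA.1 γ (hES hγ) (by rintro rfl; exact hρA.2 hγ) k hk
      have hβε : ρ ⊓ γ ≤ ε := by
        intro j
        by_cases hj : j = k
        · subst hj; exact (min_le_left _ _).trans hεk.le
        · exact (hε2 j hj).1
      have hεi : ε i = γ i := by
        have := (hε2 i hik).2 (by omega)
        omega
      have hβk : (ρ ⊓ γ) k = ρ k := by simp only [infa]; omega
      have hβi : (ρ ⊓ γ) i = γ i := by simp only [infa]; omega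
      obtain ⟨x, hx, hβx, hxk, hxm⟩ := minel h1 (ρ ⊓ γ) k ⟨ε, hε, hβε, by omega⟩
      have hxi : x i = γ i := by
        have := lej (hxm ε hε hβε (by omega)) i
        have := lej (hβx) i
        omega
      have hshield : ∀ z ∈ S, x ≤ z → z i = x i → z ∈ S \ E := by
        intro z hz hxz hzi
        refine ⟨hz, fun hzE => ?_⟩
        have hzk := lej (hxz) k
        obtain ⟨η, hη, hηi, hη2⟩ := e2 γ hγ z hzE (by rintro rfl; omega) i (by omega)
        have hηk : η k = γ k := by
          have := (hη2 k hik.symm).2 (by omega)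
          omega
        have hle2 : ρ ⊓ γ ≤ η := by
          intro j
          have hl := lej ((hβx.trans hxz)) j
          simp only [infa] at hl ⊢
          by_cases hj : j = i
          · subst hj; omega
          · have := (hη2 j hj).1
            omega
        have := hmax η ⟨hη, by omega, (le_inf inf_le_left hγl).trans hle2⟩
        have hlt : ∑ j, min (ρ j) (γ j) < ∑ j, min (ρ j) (η j) := by
          refine Finset.sum_lt_sum (fun l _ => ?_) ⟨i, Finset.mem_univ _, by omega⟩
          have := lej (hle2) l
          simp only [infa] at this
          omega
        omega
      refine ⟨x, ⟨hshield x hx le_rfl rfl, fun j => ?_⟩,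
        (le_inf inf_le_left hγl).trans hβx, by omega⟩
      obtain ⟨σ, hσ, s1, s2⟩ := hρ.2 k
      have hxσ : x ≤ σ := hxm σ (Qs_sub hσ).1 (inf_le_left.trans s1) (by omega)
      have := lej (s1) i
      exact star hAS h1 h2 n x hx i hshield σ hσ hxσ (by omega) j

/-- The local structure at `α`: a covering by larger elements of a set that is downward closed in
`A` yields a dominating element or a complete infimum. -/
theorem cells {d : ℕ} (hd : 1 ≤ d) {S E P : Set (Fin d → ℕ)} (h1 : PropG1 S) (h2 : PropG2 S)
    (e1 : PropG1 E) (hP : P ⊆ S \ E)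
    (hdown : ∀ x ∈ S \ E, ∀ y ∈ P, x ≤ y → x ∈ P) (α : Fin d → ℕ) (hα : α ∈ S \ E)
    (hcov : ∀ i, ∃ δ ∈ P, α ≤ δ ∧ α i < δ i) (hnd : ¬ ∃ δ ∈ P, ∀ j, α j < δ j) :
    ∃ r : ℕ, 1 < r ∧ r ≤ d ∧ ∃ β : Fin r → Fin d → ℕ, (∀ k, β k ∈ P) ∧
      IsCompleteInfIn S (S \ E) α β := by
  classical
  have hm : ∀ i, ∃ x ∈ S, α ≤ x ∧ α i < x i ∧ ∀ z ∈ S, α ≤ z → α i < z i → x ≤ z := by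
    intro i
    obtain ⟨δ, hδ, a, b⟩ := hcov i
    exact minel h1 α i ⟨δ, (hP hδ).1, a, b⟩
  choose m hmS hαm hmi hmm using hm
  have hsymm : ∀ i j, α j < m i j → α i < m j i := by
    intro i j hij
    by_contra hji
    have hji' : α i = m j i := le_antisymm (hαm j i) (not_lt.1 hji)
    have hmj := hmi j
    obtain ⟨ε, hε, hεi, hε2⟩ := h2 α hα.1 (m j) (hmS j)
      (by intro h; rw [← h] at hmj; omega) i hji'
    have hne : j ≠ i := by rintro rfl; omega
    have hαε : α ≤ ε := by
      intro l
      change α l ≤ ε l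
      by_cases hl : l = i
      · subst hl; exact hεi.le
      · have := (hε2 l hl).1
        have := lej (hαm j) l
        omega
    have a := lej (hmm i ε hε hαε hεi) j
    have := (hε2 j hne).2 (by omega)
    omega
  have heq : ∀ i j, α j < m i j → m i = m j := by
    intro i j hij
    exact le_antisymm (hmm i _ (hmS j) (hαm j) (hsymm i j hij)) (hmm j _ (hmS i) (hαm i) hij)
  -- choice of the special index
  obtain ⟨l, hl⟩ : ∃ l, ∀ i, m i ∈ E → α i < m l i := by
    by_cases hex : ∃ l, m l ∈ E
    · obtain ⟨l, hlE⟩ := hex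
      refine ⟨l, fun i hiE => ?_⟩
      by_contra hcon
      apply hα.2
      have : α = m l ⊓ m i := by
        funext j
        simp only [infa]
        have a := lej (hαm l) j
        have b := lej (hαm i) j
        by_contra hne
        have c1 : m l = m j := heq l j (by omega)
        have c2 : m i = m j := heq i j (by omega)
        have := hmi i
        rw [c1, ← c2] at hcon
        exact hcon this
      rw [this]
      exact e1 _ hlE _ hiE
    · exact ⟨⟨0, hd⟩, fun i hi => absurd ⟨i, hi⟩ hex⟩
  obtain ⟨δ, hδ, hαδ, hδl⟩ := hcov l
  have hδS : δ ∈ S := (hP hδ).1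
  have hδm : ∀ i j, ¬ α i < δ i → α j < m i j → ¬ α j < δ j := by
    intro i j hi hij hj
    apply hi
    have := lej (hmm j δ hδS hαδ hj) i
    have := hsymm i j hij
    omega
  have hmP : ∀ i, ¬ α i < δ i → m i ∈ P := by
    intro i hi
    obtain ⟨δ', hδ', a, b⟩ := hcov i
    refine hdown _ ⟨hmS i, fun hE => ?_⟩ δ' hδ' (hmm i δ' (hP hδ').1 a b)
    have := hl i hE
    have := lej (hmm l δ hδS hαδ hδl) i
    omega
  let O : Finset (Fin d) := Finset.univ.filter fun i => ¬ α i < δ i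
  let Z : Finset (Fin d → ℕ) := insert δ (O.image m)
  have hO : ∀ i, i ∈ O ↔ ¬ α i < δ i := fun i => by simp [O]
  have hZ : ∀ z, z ∈ Z ↔ z = δ ∨ ∃ i, ¬ α i < δ i ∧ m i = z := fun z => by
    simp [Z, O]
  obtain ⟨o, ho⟩ : ∃ o, ¬ α o < δ o := by
    by_contra hh; push Not at hh; exact hnd ⟨δ, hδ, hh⟩
  have hOcard : (O.image m).card < d := by
    refine lt_of_le_of_lt Finset.card_image_le ?_
    have : O ⊂ Finset.univ := by
      rw [Finset.ssubset_univ_iff]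
      intro h
      have : l ∈ O := by rw [h]; exact Finset.mem_univ _
      exact (hO l).1 this hδl
    have := Finset.card_lt_card this
    simpa using this
  have hδO : δ ∉ O.image m := by
    intro h
    obtain ⟨i, hi, hiδ⟩ := Finset.mem_image.1 h
    have a := (hO i).1 hi
    have := hmi i
    rw [hiδ] at this
    exact a this
  have hZcard : Z.card = (O.image m).card + 1 := Finset.card_insert_of_notMem hδO
  have hOpos : 0 < (O.image m).card :=
    Finset.card_pos.2 ⟨m o, Finset.mem_image_of_mem _ ((hO o).2 ho)⟩
  have hZP : ∀ z ∈ Z, z ∈ P := by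
    intro z hz
    rcases (hZ z).1 hz with rfl | ⟨i, hi, rfl⟩
    · exact hδ
    · exact hmP i hi
  have hZα : ∀ z ∈ Z, α ≤ z := by
    intro z hz
    rcases (hZ z).1 hz with rfl | ⟨i, hi, rfl⟩
    · exact hαδ
    · exact hαm i
  have hpair : ∀ z ∈ Z, ∀ w ∈ Z, z ≠ w → ∀ j, α j < z j → ¬ α j < w j := by
    intro z hz w hw hzw j hzj hwj
    rcases (hZ z).1 hz with rfl | ⟨i, hi, rfl⟩ <;> rcases (hZ w).1 hw with rfl | ⟨i', hi', rfl⟩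
    · exact hzw rfl
    · exact hδm i' j hi' hwj hzj
    · exact hδm i j hi hzj hwj
    · exact hzw ((heq i j hzj).trans (heq i' j hwj).symm)
  let e := Z.equivFin
  refine ⟨Z.card, by omega, by omega, fun k => (e.symm k).1, fun k => hZP _ (e.symm k).2, hα,
    fun k => hP (hZP _ (e.symm k).2), by omega,
    fun k => Finset.univ.filter fun i => (e.symm k).1 i = α i, ?_, ?_, ?_, ?_⟩
  · intro k
    dsimp only
    generalize e.symm k = z
    obtain ⟨z, hz⟩ := z
    simp only
    rcases (hZ z).1 hz with rfl | ⟨i, hi, rfl⟩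
    · constructor
      · refine ⟨o, ?_⟩
        have := lej (hαδ) o
        simp only [Finset.mem_filter, Finset.mem_univ, true_and]
        omega
      · intro h
        have : l ∈ Finset.univ.filter fun i => z i = α i := by rw [h]; exact Finset.mem_univ _
        simp only [Finset.mem_filter, Finset.mem_univ, true_and] at this
        omega
    · constructor
      · refine ⟨l, ?_⟩
        have a := lej (hαm i) l
        have b : ¬ α l < m i l := fun h => hδm i l hi h hδl
        simp only [Finset.mem_filter, Finset.mem_univ, true_and]
        omega
      · intro h
        have : i ∈ Finset.univ.filter fun j => m i j = α j := by rw [h]; exact Finset.mem_univ _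
        simp only [Finset.mem_filter, Finset.mem_univ, true_and] at this
        have := hmi i
        omega
  · intro k
    refine ⟨(hP (hZP _ (e.symm k).2)).1, ?_, ?_⟩
    · intro i hi
      simpa using hi
    · intro j hj
      have := lej (hZα _ (e.symm k).2) j
      simp only [Finset.mem_filter, Finset.mem_univ, true_and] at hj
      dsimp only
      omega
  · intro j k hjk
    have hne : (e.symm j).1 ≠ (e.symm k).1 := by
      intro h
      exact hjk (e.symm.injective (Subtype.ext h))
    funext t
    have a := lej (hZα _ (e.symm j).2) t
    have b := lej (hZα _ (e.symm k).2) t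
    have c := hpair _ (e.symm j).2 _ (e.symm k).2 hne t
    simp only [infa]
    omega
  · intro x
    have : ∃ z ∈ Z, α x < z x := by
      by_cases hx : α x < δ x
      · exact ⟨δ, (hZ δ).2 (Or.inl rfl), hx⟩
      · exact ⟨m x, (hZ _).2 (Or.inr ⟨x, hx, rfl⟩), hmi x⟩
    obtain ⟨z, hz, hzx⟩ := this
    refine ⟨e ⟨z, hz⟩, ?_⟩
    simp only [Finset.mem_filter, Finset.mem_univ, true_and, Equiv.symm_apply_apply]
    omega

theorem Qs_eq {d : ℕ} (hd : 1 ≤ d) {S E : Set (Fin d → ℕ)} (h1 : PropG1 S) (h2 : PropG2 S)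
    (e1 : PropG1 E) (n : ℕ) : (S \ E) \ Dacc S E n = Qs (S \ E) n := by
  induction n with
  | zero => simp [Dacc, Qs]
  | succ n ih =>
    ext α
    have hiff : α ∈ (S \ E) \ Dacc S E (n + 1) ↔
        α ∈ Qs (S \ E) n ∧ α ∉ Dstep S E (Dacc S E n) := by
      rw [← ih]
      simp only [Dacc, Set.mem_sdiff, Set.mem_union]
      tauto
    rw [hiff]
    have hB : ∀ x, x ∈ Bstep S E (Dacc S E n) ↔
        x ∈ Qs (S \ E) n ∧ ¬ ∃ δ ∈ Qs (S \ E) n, ∀ j, x j < δ j := by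
      intro x
      simp only [Bstep, ih, Set.mem_ofPred_eq, DomLE]
      refine and_congr_right fun hx => ?_
      constructor
      · rintro h ⟨δ, hδ, hlt⟩
        have := h δ hδ (Or.inr hlt)
        have h0 := hlt ⟨0, hd⟩
        rw [this] at h0
        omega
      · rintro h δ hδ (hd' | hlt)
        · exact hd'.symm
        · exact absurd ⟨δ, hδ, hlt⟩ h
    constructor
    · rintro ⟨hα, hD⟩
      refine ⟨Qs_sub hα, fun i => ?_⟩
      by_cases hb : α ∈ Bstep S E (Dacc S E n)
      · have hC : α ∈ Cstep S E (Dacc S E n) := by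
          by_contra hC
          exact hD ⟨hb, hC⟩
        obtain ⟨_, r, _, _, β, hβ, _, _, _, F, _, hF2, _, hF4⟩ := hC
        obtain ⟨j, hj⟩ := hF4 i
        obtain ⟨_, f1, f2⟩ := hF2 j
        refine ⟨β j, ((hB _).1 (hβ j)).1, fun t => ?_, f2 i hj⟩
        by_cases ht : t ∈ F j
        · exact (f1 t ht).ge
        · exact (f2 t ht).le
      · rw [hB] at hb
        have : ∃ δ ∈ Qs (S \ E) n, ∀ j, α j < δ j := by
          by_contra hh
          exact hb ⟨hα, hh⟩
        obtain ⟨δ, hδ, hlt⟩ := this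
        exact ⟨δ, hδ, fun j => (hlt j).le, hlt i⟩
    · intro hα
      refine ⟨Qs_anti hα, fun hD => ?_⟩
      have hb := hD.1
      have hnd := ((hB α).1 hb).2
      apply hD.2
      obtain ⟨r, r1, r2, β, hβ, hinf⟩ := cells hd h1 h2 e1 (P := Qs (S \ E) n)
        (fun x hx => Qs_sub hx) (fun x hx y hy hxy => Qs_down hy hx hxy) α hα.1 hα.2 hnd
      refine ⟨hb, r, r1, r2, β, fun k => (hB _).2 ⟨hβ k, ?_⟩, hinf⟩
      rintro ⟨η, hη, hlt⟩
      apply hnd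
      refine ⟨η, hη, fun j => ?_⟩
      obtain ⟨_, _, _, F, _, hF2, _, _⟩ := hinf
      obtain ⟨_, f1, f2⟩ := hF2 k
      have := hlt j
      by_cases hj : j ∈ F k
      · have := f1 j hj; omega
      · have := f2 j hj; omega

theorem Dstep_eq {d : ℕ} (hd : 1 ≤ d) {S E : Set (Fin d → ℕ)} (h1 : PropG1 S) (h2 : PropG2 S)
    (e1 : PropG1 E) (n : ℕ) (α : Fin d → ℕ) : α ∈ Dstep S E (Dacc S E n) ↔
      α ∈ Qs (S \ E) n ∧ α ∉ Qs (S \ E) (n + 1) := by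
  rw [← Qs_eq hd h1 h2 e1 n, ← Qs_eq hd h1 h2 e1 (n + 1)]
  have : α ∈ Dstep S E (Dacc S E n) → α ∈ (S \ E) \ Dacc S E n := fun h => h.1.1
  simp only [Dacc, Set.mem_sdiff, Set.mem_union] at *
  tauto

/-- Equality up to the conductor. -/
def CapEq {d : ℕ} (c α α' : Fin d → ℕ) : Prop :=
  ∀ j, α j = α' j ∨ (c j ≤ α j ∧ c j ≤ α' j)

theorem CapEq.symm {d : ℕ} {c α α' : Fin d → ℕ} (h : CapEq c α α') : CapEq c α' α := by
  intro j
  rcases h j with h | h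
  · exact Or.inl h.symm
  · exact Or.inr h.symm

theorem cap_raise {d : ℕ} {X : Set (Fin d → ℕ)} (h1 : PropG1 X) (h2 : PropG2 X)
    {c : Fin d → ℕ} (hc : ∀ x, c ≤ x → x ∈ X) {α : Fin d → ℕ} (hα : α ∈ X) (j : Fin d)
    (hj : c j ≤ α j) (v : ℕ) (hv : c j ≤ v) : Function.update α j v ∈ X := by
  have hup : ∀ n : ℕ, ∃ x ∈ X, (∀ t, t ≠ j → x t = α t) ∧ n ≤ x j ∧ c j ≤ x j := by
    intro n
    induction n with
    | zero => exact ⟨α, hα, fun _ _ => rfl, Nat.zero_le _, hj⟩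
    | succ n ih =>
      obtain ⟨x, hx, x1, x2, x3⟩ := ih
      let ω : Fin d → ℕ := fun t => if t = j then x j else x t + c t + 1
      have hω : ω ∈ X := hc _ fun t => by
        simp only [ω]
        split_ifs with h
        · subst h; exact x3
        · omega
      by_cases hne : x = ω
      · refine ⟨x + 1, hc _ fun t => ?_, fun t ht => ?_, ?_, ?_⟩
        · have : c t ≤ x t := by
            by_cases ht : t = j
            · subst ht; exact x3
            · have := congrFun hne t
              simp only [ω, if_neg ht] at this
              omega
          simp only [Pi.add_apply, Pi.one_apply]
          omega
        · have := congrFun hne t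
          simp only [ω, if_neg ht] at this
          omega
        · simp only [Pi.add_apply, Pi.one_apply]; omega
        · simp only [Pi.add_apply, Pi.one_apply]; omega
      · obtain ⟨ε, hε, e1, e2⟩ := h2 x hx ω hω hne j (by simp [ω])
        refine ⟨ε, hε, fun t ht => ?_, by omega, by omega⟩
        have := (e2 t ht).2 (by simp only [ω, if_neg ht]; omega)
        simp only [ω, if_neg ht] at this
        rw [this, ← x1 t ht]
        omega
  obtain ⟨x, hx, x1, x2, x3⟩ := hup v
  let ω : Fin d → ℕ := fun t => if t = j then v else x t + c t + 1
  have hω : ω ∈ X := hc _ fun t => by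
    simp only [ω]
    split_ifs with h
    · subst h; exact hv
    · omega
  have : Function.update α j v = x ⊓ ω := by
    funext t
    simp only [infa, ω, Function.update_apply]
    by_cases ht : t = j
    · subst ht; simp; omega
    · rw [if_neg ht, if_neg ht, ← x1 t ht]; omega
  rw [this]
  exact h1 x hx ω hω

theorem cap_mem {d : ℕ} {X : Set (Fin d → ℕ)} (h1 : PropG1 X) (h2 : PropG2 X)
    {c : Fin d → ℕ} (hc : ∀ x, c ≤ x → x ∈ X) {α α' : Fin d → ℕ} (hα : α ∈ X)
    (hcap : CapEq c α α') : α' ∈ X := by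
  classical
  have key : ∀ T : Finset (Fin d), (fun t => if t ∈ T then α' t else α t) ∈ X := by
    intro T
    induction T using Finset.induction_on with
    | empty => simpa using hα
    | insert j T hj ih =>
      have hEq : (fun t => if t ∈ insert j T then α' t else α t) =
          Function.update (fun t => if t ∈ T then α' t else α t) j (α' j) := by
        funext t
        by_cases ht : t = j
        · subst ht; simp
        · simp [ht]
      rw [hEq]
      rcases hcap j with h | h
      · rw [Function.update_eq_self_iff.2]
        · exact ih
        · simp [hj, h]
      · exact cap_raise h1 h2 hc ih j (by simp [hj, h.1]) _ h.2
  simpa using key Finset.univ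

theorem cap_Qs {d : ℕ} {S E : Set (Fin d → ℕ)} (hES : E ⊆ S) (h1 : PropG1 S) (h2 : PropG2 S)
    (e1 : PropG1 E) (e2 : PropG2 E) {c : Fin d → ℕ} (hc : ∀ x, c ≤ x → x ∈ E) (n : ℕ) :
    ∀ {α α' : Fin d → ℕ}, α ∈ Qs (S \ E) n → CapEq c α α' → α' ∈ Qs (S \ E) n := by
  have hA : ∀ {α α' : Fin d → ℕ}, α ∈ S \ E → CapEq c α α' → α' ∈ S \ E := by
    intro α α' h hcap
    exact ⟨cap_mem h1 h2 (fun x hx => hES (hc x hx)) h.1 hcap,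
      fun hE => h.2 (cap_mem e1 e2 hc hE hcap.symm)⟩
  induction n with
  | zero => exact hA
  | succ n ih =>
    intro α α' h hcap
    refine ⟨hA h.1 hcap, fun i => ?_⟩
    obtain ⟨δ, hδ, d1, d2⟩ := h.2 i
    refine ⟨fun j => if α j < c j then δ j else δ j + α' j + 1, ih hδ ?_, ?_, ?_⟩
    · intro j
      have := lej (d1) j
      by_cases hj : α j < c j
      · simp [hj]
      · simp only [if_neg hj]; right; omega
    · intro j
      have := lej (d1) j
      have := hcap j
      by_cases hj : α j < c j
      · simp only [if_pos hj]; omega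
      · simp only [if_neg hj]; omega
    · have := hcap i
      by_cases hj : α i < c i
      · simp only [if_pos hj]; omega
      · simp only [if_neg hj]; omega


theorem stmt_18 {d : ℕ} (hd : 1 ≤ d) (S E : Set (Fin d → ℕ))
    (hS : IsGoodSemigroup S) (hE : IsGoodIdeal S E) (hprop : E ≠ S)
    (cE : Fin d → ℕ) (hcE : IsConductor E cE)
    (N : ℕ) (hN : IsLevelsNumber S E N)
    (U : Finset (Fin d)) (hU : U.Nonempty)
    (i : ℕ) (α : Fin d → ℕ)
    (hαrep : ∀ j ∉ U, α j = cE j) (hαi : α ∈ Alevel S E N i)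
    (hmax : ¬ ∃ (W : Finset (Fin d)) (δ : Fin d → ℕ),
      W.Nonempty ∧ W.card < U.card ∧ (∀ j ∉ W, δ j = cE j) ∧
      δ ∈ Alevel S E N i) :
    ∀ k ∈ U, ∃ β : Fin d → ℕ,
      (∀ j ∉ U, β j = cE j) ∧ β ∈ Alevel S E N i ∧ α k ≤ β k ∧
      ∀ γ : Fin d → ℕ, IsSubspaceRep S cE U γ → γ k = β k → γ ∈ S \ E := by
  obtain ⟨_, _, h1, h2, _⟩ := hS
  obtain ⟨hES, _, _, e1, e2⟩ := hE
  have hc := hcE.1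
  change PropG1 S at h1
  change PropG2 S at h2
  change PropG1 E at e1
  change PropG2 E at e2
  have hiN : 1 ≤ i ∧ i ≤ N := by
    by_contra h
    simp [Alevel, h] at hαi
  have hlev : ∀ x, x ∈ Alevel S E N i ↔
      x ∈ Qs (S \ E) (N - i) ∧ x ∉ Qs (S \ E) (N - i + 1) := by
    intro x
    rw [Alevel, if_pos hiN]
    exact Dstep_eq hd h1 h2 e1 (N - i) x
  generalize N - i = n at hlev
  have hcapQ := fun n => @cap_Qs d S E hES h1 h2 e1 e2 cE hc n
  -- elements of the level with large coordinates off `U` have small coordinates on `U`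
  have hsmall : ∀ x, x ∈ Alevel S E N i → (∀ j ∉ U, cE j ≤ x j) → ∀ j ∈ U, x j < cE j := by
    intro x hx hxU j hj
    by_contra hcon
    apply hmax
    have hcap : CapEq cE x (fun t => min (x t) (cE t)) := by
      intro t; simp only; omega
    refine ⟨Finset.univ.filter fun t => x t < cE t, fun t => min (x t) (cE t), ?_, ?_, ?_, ?_⟩
    · by_contra hne
      rw [Finset.not_nonempty_iff_eq_empty, Finset.filter_eq_empty_iff] at hne
      have : x ∈ E := hc x fun t => not_lt.1 (hne (Finset.mem_univ t))
      exact (Qs_sub ((hlev x).1 hx).1).2 this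
    · apply Finset.card_lt_card
      rw [Finset.ssubset_iff_of_subset]
      · exact ⟨j, hj, by simpa using hcon⟩
      · intro t ht
        simp only [Finset.mem_filter, Finset.mem_univ, true_and] at ht
        by_contra htU
        have := hxU t htU
        omega
    · intro t ht
      simp only [Finset.mem_filter, Finset.mem_univ, true_and] at ht
      simp only; omega
    · rw [hlev] at hx ⊢
      exact ⟨hcapQ _ hx.1 hcap, fun h => hx.2 (hcapQ _ h hcap.symm)⟩
  intro k hk
  obtain ⟨β, ⟨hβU, hβ, hαβ⟩, hβmax⟩ := exists_max_of
    (fun β : Fin d → ℕ => (∀ j ∉ U, β j = cE j) ∧ β ∈ Alevel S E N i ∧ α k ≤ β k)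
    (fun β => β k) (cE k) (fun β hβ => (hsmall β hβ.2.1 (fun j hj => (hβ.1 j hj).ge) k hk).le)
    ⟨α, hαrep, hαi, le_rfl⟩
  refine ⟨β, hβU, hβ, hαβ, fun γ hγ hγk => ⟨hγ.1, fun hγE => ?_⟩⟩
  have hβ' := (hlev β).1 hβ
  obtain ⟨δ₀, hδ₀, d1, d2⟩ := claim hES h1 h2 e1 e2 n β hβ'.1 γ hγE k hγk.symm
  have hδ₀U : ∀ j ∉ U, cE j ≤ δ₀ j := by
    intro j hj
    have := lej (d1) j
    have := hβU j hj
    have := hγ.2 j hj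
    simp only [infa] at *
    omega
  obtain ⟨δ, ⟨hδ, hδU, hδk⟩, hδmax⟩ := exists_max_of
    (fun δ => δ ∈ Qs (S \ E) n ∧ (∀ j ∉ U, cE j ≤ δ j) ∧ β k < δ k)
    (fun δ => ∑ j, min (δ j) (cE j)) (∑ j, cE j)
    (fun δ _ => Finset.sum_le_sum fun j _ => min_le_right _ _) ⟨δ₀, hδ₀, hδ₀U, d2⟩
  have hδlev : δ ∈ Alevel S E N i := by
    rw [hlev]
    refine ⟨hδ, fun hδ' => ?_⟩
    have : ∃ j, δ j < cE j := by
      by_contra hh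
      push Not at hh
      exact (Qs_sub hδ).2 (hc δ hh)
    obtain ⟨j, hj⟩ := this
    obtain ⟨η, hη, hle, hlt⟩ := hδ'.2 j
    have := hδmax η ⟨hη, fun t ht => (hδU t ht).trans (hle t), lt_of_lt_of_le hδk (hle k)⟩
    have hs : ∑ t, min (δ t) (cE t) < ∑ t, min (η t) (cE t) := by
      refine Finset.sum_lt_sum (fun t _ => ?_) ⟨j, Finset.mem_univ _, by omega⟩
      have := lej (hle) t
      omega
    omega
  have hδsm := hsmall δ hδlev hδU
  have hcap : CapEq cE δ (fun t => min (δ t) (cE t)) := by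
    intro t; simp only; omega
  have hfin : (fun t => min (δ t) (cE t)) ∈ Alevel S E N i := by
    rw [hlev] at hδlev ⊢
    exact ⟨hcapQ _ hδlev.1 hcap, fun h => hδlev.2 (hcapQ _ h hcap.symm)⟩
  have hk1 := hδsm k hk
  have := hβmax _ ⟨fun j hj => by have := hδU j hj; omega, hfin, by omega⟩
  omega
end
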